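/- arXiv:2207.14759 — 2 statements merged into one kernel-verified Lean document; each statement's English description precedes it below -/
import Mathlib

section
/- Let G be a graph and e = vw an edge of G that is contained in no even cycle. Then for every perfectly matchable set S of G, either every perfect matching of G[S] contains e or no perfect matching of G[S] contains e. -/
open Polynomial

variable {V : Type*}

/-- `M` (a finite set of edges) is a matching of the graph `G`:
its members are edges of `G` and no two distinct members share an endpoint. -/
def IsGraphMatching (G : SimpleGraph V) (M : Finset (Sym2 V)) : Prop :=
  (M : Set (Sym2 V)) ⊆ G.edgeSet ∧
    ∀ e ∈ M, ∀ f ∈ M, e ≠ f → ∀ x, x ∈ e → x ∉ f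

/-- The set of vertices covered by the edge set `M` is exactly `S`. -/
def Covers (M : Finset (Sym2 V)) (S : Finset V) : Prop :=
  ∀ x, x ∈ S ↔ ∃ e ∈ M, x ∈ e

/-- `M` is a perfect matching of the induced subgraph `G[S]`. -/
def IsPerfectMatchingOn (G : SimpleGraph V) (M : Finset (Sym2 V)) (S : Finset V) : Prop :=
  IsGraphMatching G M ∧ Covers M S

/-- `S` is a perfectly matchable set of `G`. -/
def IsPMS (G : SimpleGraph V) (S : Finset V) : Prop :=
  ∃ M, IsPerfectMatchingOn G M S

open Classical in
/-- The perfectly matchable set polynomial of the subgraph of `G` induced on the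
ground vertex set `A`: the generating function `∑ p_{2k} z^k` where `p_{2k}` is the number
of perfectly matchable sets `S ⊆ A` with `|S| = 2k`. -/
noncomputable def pmPoly [Fintype V] (G : SimpleGraph V) (A : Finset V) : Polynomial ℤ :=
  ∑ S ∈ A.powerset, if IsPMS G S then X ^ (S.card / 2) else 0

/-- `G` has no cycle of even length. -/
def NoEvenCycle (G : SimpleGraph V) : Prop :=
  ∀ (v : V) (c : G.Walk v v), c.IsCycle → ¬ Even c.length

/-- The partner function of a perfect matching of `G[S]`. -/
theorem IsPerfectMatchingOn.exists_involutive {G : SimpleGraph V} {M : Finset (Sym2 V)}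
    {S : Finset V} (h : IsPerfectMatchingOn G M S) :
    ∃ f : S → S, Function.Involutive f ∧ ∀ x y : S, s((x : V), (y : V)) ∈ M ↔ y = f x := by
  obtain ⟨⟨hsub, hdisj⟩, hcov⟩ := h
  have huniq : ∀ a b c : V, s(a, b) ∈ M → s(a, c) ∈ M → b = c := by
    intro a b c hb hc
    by_contra hne
    exact hdisj _ hb _ hc (fun h => hne (Sym2.congr_right.1 h)) a (by simp) (by simp)
  have hex : ∀ x : S, ∃ y : S, s((x : V), (y : V)) ∈ M := by
    rintro ⟨x, hx⟩
    obtain ⟨e, he, hxe⟩ := (hcov x).1 hx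
    obtain ⟨y, rfl⟩ := Sym2.mem_iff_exists.1 hxe
    exact ⟨⟨y, (hcov y).2 ⟨_, he, by simp⟩⟩, he⟩
  choose f hf using hex
  refine ⟨f, fun x => ?_, fun x y => ⟨fun hxy => Subtype.ext (huniq _ _ _ hxy (hf x)), ?_⟩⟩
  · exact Subtype.ext (huniq _ _ _ (hf (f x)) (Sym2.eq_swap ▸ hf x))
  · rintro rfl
    exact hf x

/-- The orbit of `a` under alternately applying `f` and `g`, starting with `f`. -/
def alternatingOrbit {W : Type*} (f g : W → W) (a : W) : ℕ → W
  | 0 => a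
  | n + 1 => if Even n then f (alternatingOrbit f g a n) else g (alternatingOrbit f g a n)

/-- The alternating orbit of two fixed-point-free involutions of a finite type closes up after an
even number of steps, without repetition before that. -/
theorem exists_alternatingOrbit_eq {W : Type*} [Finite W] {f g : W → W}
    (hf : Function.Involutive f) (hg : Function.Involutive g) (hf' : ∀ x, f x ≠ x)
    (hg' : ∀ x, g x ≠ x) (a : W) :
    ∃ d, 0 < d ∧ alternatingOrbit f g a (2 * d) = a ∧
      Set.InjOn (alternatingOrbit f g a) (Set.Iio (2 * d)) := by
  classical
  set x := alternatingOrbit f g a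
  have hs : ∀ n, x (n + 1) = if Even n then f (x n) else g (x n) := fun n => rfl
  have hne : ∀ n, x n ≠ x (n + 1) := by
    intro n
    rw [hs]
    split_ifs
    exacts [(hf' _).symm, (hg' _).symm]
  have hodd : ∀ d i, x i ≠ x (i + 2 * d + 1) := by
    intro d
    induction d with
    | zero => exact hne
    | succ d ih =>
      intro i hi
      apply ih (i + 1)
      have h1 := hs (i + 2 * (d + 1))
      have h2 := hs i
      have hp : Even (i + 2 * (d + 1)) ↔ Even i := by simp [parity_simps]
      rw [← hi] at h1
      simp only [hp] at h1
      have e : i + 1 + 2 * d + 1 = i + 2 * (d + 1) := by ring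
      rw [e]
      split_ifs at h1 h2
      · rw [h2, h1, hf]
      · rw [h2, h1, hg]
  have hback : ∀ d i, x i = x (i + 2 * d) → x (2 * d) = a := by
    intro d i
    induction i with
    | zero => intro h; rw [Nat.zero_add] at h; exact h.symm
    | succ i ih =>
      intro h
      apply ih
      have h1 := hs (i + 2 * d)
      have h2 := hs i
      have hp : Even (i + 2 * d) ↔ Even i := by simp [parity_simps]
      have e : i + 1 + 2 * d = i + 2 * d + 1 := by ring
      rw [e] at h
      rw [← h, h2] at h1
      simp only [hp] at h1
      split_ifs at h1
      · exact hf.injective h1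
      · exact hg.injective h1
  have hex : ∃ d, 0 < d ∧ x (2 * d) = a := by
    obtain ⟨i, j, hij, h⟩ := Finite.exists_ne_map_eq_of_infinite (fun n => x (2 * n))
    wlog hlt : i < j generalizing i j
    · exact this j i hij.symm h.symm (by omega)
    refine ⟨j - i, by omega, hback _ (2 * i) ?_⟩
    have e : 2 * i + 2 * (j - i) = 2 * j := by omega
    rw [e]
    exact h
  obtain ⟨hd, hda⟩ := Nat.find_spec hex
  refine ⟨Nat.find hex, hd, hda, ?_⟩
  have hlt : ∀ i j, i < j → j < 2 * Nat.find hex → x i ≠ x j := by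
    intro i j hij hj h
    obtain ⟨d, hd' | hd'⟩ := Nat.even_or_odd' (j - i)
    · obtain rfl : j = i + 2 * d := by omega
      exact Nat.find_min hex (m := d) (by omega) ⟨by omega, hback _ _ h⟩
    · obtain rfl : j = i + 2 * d + 1 := by omega
      exact hodd _ _ h
  intro i hi j hj h
  rcases lt_trichotomy i j with hij | hij | hij
  · exact (hlt _ _ hij hj h).elim
  · exact hij
  · exact (hlt _ _ hij hi h.symm).elim

/-- A sequence of consecutively adjacent vertices spells out a walk. -/
theorem SimpleGraph.exists_walk_of_adj_succ {G : SimpleGraph V} (x : ℕ → V)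
    (hadj : ∀ n, G.Adj (x n) (x (n + 1))) (m n : ℕ) :
    ∃ p : G.Walk (x m) (x (m + n)), p.length = n ∧
      p.support = (List.range' m (n + 1)).map x ∧
      p.edges = (List.range' m n).map fun i => s(x i, x (i + 1)) := by
  induction n generalizing m with
  | zero => exact ⟨.nil, by simp⟩
  | succ n ih =>
    obtain ⟨p, hl, hsupp, hedges⟩ := ih (m + 1)
    have e : m + 1 + n = m + (n + 1) := by ring
    refine ⟨(SimpleGraph.Walk.cons (hadj m) p).copy rfl (by rw [e]), ?_, ?_, ?_⟩
    · simp [hl]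
    · simp [hsupp, List.range'_succ]
    · simp [hedges, List.range'_succ]

/-- A closed sequence of at least three distinct, consecutively adjacent vertices spells out a
cycle. -/
theorem SimpleGraph.exists_isCycle_of_adj_succ {G : SimpleGraph V} (x : ℕ → V)
    (hadj : ∀ n, G.Adj (x n) (x (n + 1))) {n : ℕ} (hn : 3 ≤ n) (hclosed : x n = x 0)
    (hinj : Set.InjOn x (Set.Iio n)) :
    ∃ c : G.Walk (x 0) (x 0), c.IsCycle ∧ c.length = n ∧ s(x 0, x 1) ∈ c.edges := by
  obtain ⟨p, hl, hsupp, hedges⟩ := exists_walk_of_adj_succ x hadj 1 (n - 1)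
  have e : x (1 + (n - 1)) = x 0 := by rw [← hclosed]; congr 1; omega
  have hinj' : ∀ i j, 1 ≤ i → i ≤ n → 1 ≤ j → j ≤ n → x i = x j → i = j := by
    intro i j hi hin hj hjn h
    rcases hin.lt_or_eq with hi' | rfl <;> rcases hjn.lt_or_eq with hj' | rfl
    · exact hinj hi' hj' h
    · have := hinj hi' (show 0 ∈ Set.Iio j by simp; omega) (h.trans hclosed)
      omega
    · have := hinj (show 0 ∈ Set.Iio i by simp; omega) hj' (hclosed.symm.trans h)
      omega
    · rfl
  refine ⟨.cons (hadj 0) (p.copy rfl e), ?_, by simp [hl]; omega, by simp⟩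
  rw [SimpleGraph.Walk.cons_isCycle_iff]
  refine ⟨?_, ?_⟩
  · rw [SimpleGraph.Walk.isPath_def, SimpleGraph.Walk.support_copy, hsupp]
    refine List.Nodup.map_on ?_ List.nodup_range'
    intro i hi j hj h
    rw [List.mem_range'_1] at hi hj
    exact hinj' i j (by omega) (by omega) (by omega) (by omega) h
  · rw [SimpleGraph.Walk.edges_copy, hedges, List.mem_map]
    rintro ⟨i, hi, h⟩
    rw [List.mem_range'_1] at hi
    rw [← hclosed, Sym2.eq_iff] at h
    rcases h with ⟨h, -⟩ | ⟨h, h'⟩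
    · have := hinj' i n (by omega) (by omega) (by omega) (by omega) h
      omega
    · have h1 := hinj' i 1 (by omega) (by omega) (by omega) (by omega) h
      have h2 := hinj' (i + 1) n (by omega) (by omega) (by omega) (by omega) h'
      omega

/-- if the edge `e = vw` lies on no even cycle, then for every perfectly
matchable set `S`, either every perfect matching of `G[S]` contains `e`, or none does. -/
theorem stmt3 (G : SimpleGraph V) (v w : V) (hvw : G.Adj v w)
    (he : ∀ (a : V) (c : G.Walk a a), c.IsCycle → Even c.length → s(v, w) ∉ c.edges)
    (S : Finset V) (hS : IsPMS G S) :
    (∀ M : Finset (Sym2 V), IsPerfectMatchingOn G M S → s(v, w) ∈ M) ∨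
    (∀ M : Finset (Sym2 V), IsPerfectMatchingOn G M S → s(v, w) ∉ M) := by
  by_contra hcon
  push Not at hcon
  obtain ⟨⟨N, hN, heN⟩, ⟨M, hM, heM⟩⟩ := hcon
  obtain ⟨f, hf, hfM⟩ := hM.exists_involutive
  obtain ⟨g, hg, hgN⟩ := hN.exists_involutive
  have hfadj : ∀ x : S, G.Adj (x : V) (f x) := fun x => hM.1.1 ((hfM x _).2 rfl)
  have hgadj : ∀ x : S, G.Adj (x : V) (g x) := fun x => hN.1.1 ((hgN x _).2 rfl)
  lift v to S using (hM.2 v).2 ⟨_, heM, by simp⟩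
  lift w to S using (hM.2 w).2 ⟨_, heM, by simp⟩
  obtain ⟨d, hd, hclosed, hinj⟩ := exists_alternatingOrbit_eq hf hg
    (fun x h => (hfadj x).ne (by rw [h])) (fun x h => (hgadj x).ne (by rw [h])) v
  have hw : w = f v := (hfM v w).1 heM
  have hd1 : d ≠ 1 := by
    rintro rfl
    have hgw : g (f v) = v := by simpa [alternatingOrbit] using hclosed
    refine heN ((hgN v w).2 ?_)
    rw [hw, ← hg (f v), hgw]
  obtain ⟨c, hc, hl, hmem⟩ := SimpleGraph.exists_isCycle_of_adj_succ (G := G)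
    (fun n => ((alternatingOrbit f g v n : S) : V))
    (fun n => by
      simp only [alternatingOrbit]
      split_ifs
      exacts [hfadj _, hgadj _])
    (n := 2 * d) (by omega) (by simp only [hclosed, alternatingOrbit])
    (Subtype.val_injective.comp_injOn hinj)
  refine he _ c hc (by simp [hl]) ?_
  simpa [alternatingOrbit, hw] using hmem
end

section
/- For all k, r ≥ 0, p(Λ_{k,r}; z) = p(P_{r+1}; kz) · Π_{i=1}^{r−1} p(Λ_{k,i}; z)^{k−1}, where Λ_{k,r} is the complete k-ary tree of rank r and P_{r+1} is the path on r+1 vertices. -/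
open Polynomial

variable {V : Type*}

/-- The complete `k`-ary tree of rank `r`: vertices are the nodes at depths `0, …, r`,
encoded as functions `Fin i → Fin k` (the sequence of branch choices), and a vertex is
adjacent to each of its `k` children. -/
def karyTree (k r : ℕ) : SimpleGraph ((i : Fin (r + 1)) × (Fin (i : ℕ) → Fin k)) :=
  SimpleGraph.fromRel (fun a b =>
    ((b.1 : ℕ) = (a.1 : ℕ) + 1) ∧
      ∀ (t : ℕ) (h1 : t < (a.1 : ℕ)) (h2 : t < (b.1 : ℕ)), a.2 ⟨t, h1⟩ = b.2 ⟨t, h2⟩)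

namespace PMSet

variable {W : Type*}

/-- A perfectly matchable set is one carrying a fixed-point-free involution along edges. -/
theorem isPMS_iff_exists_involution {G : SimpleGraph V} {S : Finset V} :
    IsPMS G S ↔ ∃ σ : V → V, ∀ x ∈ S, σ x ∈ S ∧ σ (σ x) = x ∧ G.Adj x (σ x) := by
  classical
  constructor
  · rintro ⟨M, ⟨hG, hM⟩, hS⟩
    have key : ∀ x, ∃ y, x ∈ S → s(x, y) ∈ M := by
      intro x
      by_cases hx : x ∈ S
      · obtain ⟨e, he, hxe⟩ := (hS x).1 hx
        obtain ⟨y, rfl⟩ := Sym2.mem_iff_exists.1 hxe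
        exact ⟨y, fun _ => he⟩
      · exact ⟨x, fun h => absurd h hx⟩
    choose σ hσ using key
    refine ⟨σ, fun x hx => ?_⟩
    have h1 := hσ x hx
    have hadj : G.Adj x (σ x) := hG h1
    have hm : σ x ∈ S := (hS _).2 ⟨_, h1, Sym2.mem_mk_right _ _⟩
    refine ⟨hm, ?_, hadj⟩
    have h2 := hσ _ hm
    by_contra hne
    refine hM _ h1 _ h2 ?_ (σ x) (Sym2.mem_mk_right _ _) (Sym2.mem_mk_left _ _)
    intro h
    rw [Sym2.eq_swap, Sym2.congr_right] at h
    exact hne h.symm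
  · rintro ⟨σ, hσ⟩
    refine ⟨S.image fun x => s(x, σ x), ⟨?_, ?_⟩, ?_⟩
    · intro e he
      obtain ⟨x, hx, rfl⟩ := Finset.mem_image.1 (Finset.mem_coe.1 he)
      exact (hσ x hx).2.2
    · intro e he f hf hne z hze hzf
      obtain ⟨x, hx, rfl⟩ := Finset.mem_image.1 he
      obtain ⟨y, hy, rfl⟩ := Finset.mem_image.1 hf
      have hz : ∀ w ∈ S, z ∈ s(w, σ w) → s(w, σ w) = s(z, σ z) := by
        intro w hw h
        rcases Sym2.mem_iff.1 h with rfl | rfl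
        · rfl
        · rw [(hσ w hw).2.1, Sym2.eq_swap]
      exact hne ((hz x hx hze).trans (hz y hy hzf).symm)
    · intro x
      simp only [Finset.exists_mem_image, Sym2.mem_iff]
      constructor
      · exact fun hx => ⟨x, hx, Or.inl rfl⟩
      · rintro ⟨y, hy, rfl | rfl⟩
        exacts [hy, (hσ y hy).1]

theorem even_card_of_isPMS {G : SimpleGraph V} {S : Finset V} (h : IsPMS G S) :
    Even S.card := by
  obtain ⟨σ, hσ⟩ := isPMS_iff_exists_involution.1 h
  have : ∑ _x ∈ S, (1 : ZMod 2) = 0 :=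
    Finset.sum_involution (fun x _ => σ x) (fun _ _ => by decide)
      (fun x hx _ => (hσ x hx).2.2.ne') (fun x hx => (hσ x hx).1) (fun x hx => (hσ x hx).2.1)
  rw [Finset.sum_const, nsmul_one] at this
  exact (ZMod.natCast_eq_zero_iff_even).1 this

theorem isPMS_empty (G : SimpleGraph V) : IsPMS G ∅ :=
  isPMS_iff_exists_involution.2 ⟨id, by simp⟩

theorem isPMS_map {G : SimpleGraph V} {H : SimpleGraph W} (f : G ↪g H) (S : Finset V) :
    IsPMS H (S.map f.toEmbedding) ↔ IsPMS G S := by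
  classical
  simp only [isPMS_iff_exists_involution]
  constructor
  · rintro ⟨τ, hτ⟩
    have key : ∀ x, ∃ y, x ∈ S → y ∈ S ∧ f y = τ (f x) := by
      intro x
      by_cases hx : x ∈ S
      · obtain ⟨y, hy, e⟩ := Finset.mem_map.1 (hτ _ (Finset.mem_map_of_mem f.toEmbedding hx)).1
        exact ⟨y, fun _ => ⟨hy, e⟩⟩
      · exact ⟨x, fun h => absurd h hx⟩
    choose σ hσ using key
    refine ⟨σ, fun x hx => ?_⟩
    obtain ⟨h1, h2⟩ := hσ x hx
    obtain ⟨-, h3, h4⟩ := hτ _ (Finset.mem_map_of_mem f.toEmbedding hx)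
    refine ⟨h1, f.injective ?_, f.map_adj_iff.1 ?_⟩
    · rw [(hσ _ h1).2, h2]
      exact h3
    · rw [h2]
      exact h4
  · rintro ⟨σ, hσ⟩
    refine ⟨Function.extend f (f ∘ σ) id, fun y hy => ?_⟩
    obtain ⟨x, hx, rfl⟩ := Finset.mem_map.1 hy
    have e : ∀ z, Function.extend f (f ∘ σ) id (f z) = f (σ z) := fun z =>
      f.injective.extend_apply _ _ z
    have hx' := hσ x hx
    change Function.extend f (f ∘ σ) id (f x) ∈ _ ∧
      Function.extend f (f ∘ σ) id (Function.extend f (f ∘ σ) id (f x)) = f x ∧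
        H.Adj (f x) (Function.extend f (f ∘ σ) id (f x))
    rw [e, e, hx'.2.1]
    exact ⟨Finset.mem_map_of_mem f.toEmbedding hx'.1, rfl, f.map_adj_iff.2 hx'.2.2⟩

section Bridge

variable [DecidableEq V] {G : SimpleGraph V}

theorem isPMS_pair {a b : V} (h : G.Adj a b) : IsPMS G {a, b} := by
  refine isPMS_iff_exists_involution.2 ⟨fun x => if x = a then b else a, ?_⟩
  simp [h, h.symm, h.ne']

theorem IsPMS.union {S T : Finset V} (hS : IsPMS G S) (hT : IsPMS G T) (h : Disjoint S T) :
    IsPMS G (S ∪ T) := by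
  rw [isPMS_iff_exists_involution] at *
  obtain ⟨σ, hσ⟩ := hS
  obtain ⟨τ, hτ⟩ := hT
  refine ⟨fun x => if x ∈ S then σ x else τ x, fun x hx => ?_⟩
  rcases Finset.mem_union.1 hx with hx | hx
  · obtain ⟨h1, h2, h3⟩ := hσ x hx
    simp [hx, h1, h2, h3]
  · obtain ⟨h1, h2, h3⟩ := hτ x hx
    simp [Finset.disjoint_right.1 h hx, Finset.disjoint_right.1 h h1, h1, h2, h3]

theorem isPMS_union_iff {S T : Finset V} (h : Disjoint S T)
    (hadj : ∀ x ∈ S, ∀ y ∈ T, ¬ G.Adj x y) :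
    IsPMS G (S ∪ T) ↔ IsPMS G S ∧ IsPMS G T := by
  refine ⟨fun hST => ?_, fun hST => IsPMS.union hST.1 hST.2 h⟩
  simp only [isPMS_iff_exists_involution] at *
  obtain ⟨σ, hσ⟩ := hST
  refine ⟨⟨σ, fun x hx => ?_⟩, ⟨σ, fun x hx => ?_⟩⟩
  · obtain ⟨h1, h2, h3⟩ := hσ x (Finset.mem_union_left _ hx)
    exact ⟨(Finset.mem_union.1 h1).resolve_right fun h' => hadj _ hx _ h' h3, h2, h3⟩
  · obtain ⟨h1, h2, h3⟩ := hσ x (Finset.mem_union_right _ hx)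
    exact ⟨(Finset.mem_union.1 h1).resolve_left fun h' => hadj _ h' _ hx h3.symm, h2, h3⟩

theorem isPMS_union_iff_of_bridge {S T : Finset V} {a b : V} (h : Disjoint S T)
    (hab : G.Adj a b) (hadj : ∀ x ∈ S, ∀ y ∈ T, G.Adj x y → x = a ∧ y = b) :
    IsPMS G (S ∪ T) ↔ (IsPMS G S ∧ IsPMS G T) ∨
      ((a ∈ S ∧ IsPMS G (S.erase a)) ∧ b ∈ T ∧ IsPMS G (T.erase b)) := by
  constructor
  · intro hST
    simp only [isPMS_iff_exists_involution] at *
    obtain ⟨σ, hσ⟩ := hST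
    have hd := Finset.disjoint_left.1 h
    by_cases hc : a ∈ S ∧ σ a ∈ T
    · obtain ⟨haS, hT⟩ := hc
      obtain ⟨-, h2, h3⟩ := hσ a (Finset.mem_union_left _ haS)
      obtain ⟨-, hb⟩ := hadj _ haS _ hT h3
      rw [hb] at h2 h3 hT
      refine Or.inr ⟨⟨haS, σ, fun x hx => ?_⟩, hT, σ, fun x hx => ?_⟩
      · obtain ⟨hxa, hx⟩ := Finset.mem_erase.1 hx
        obtain ⟨k1, k2, k3⟩ := hσ x (Finset.mem_union_left _ hx)
        refine ⟨Finset.mem_erase.2 ⟨?_, ?_⟩, k2, k3⟩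
        · intro e
          rw [e, hb] at k2
          exact hd hx (k2 ▸ hT)
        · exact (Finset.mem_union.1 k1).resolve_right fun h' => hxa (hadj _ hx _ h' k3).1
      · obtain ⟨hxa, hx⟩ := Finset.mem_erase.1 hx
        obtain ⟨k1, k2, k3⟩ := hσ x (Finset.mem_union_right _ hx)
        refine ⟨Finset.mem_erase.2 ⟨?_, ?_⟩, k2, k3⟩
        · intro e
          rw [e, h2] at k2
          exact hd haS (k2 ▸ hx)
        · exact (Finset.mem_union.1 k1).resolve_left fun h' => hxa (hadj _ h' _ hx k3.symm).2
    · refine Or.inl ⟨⟨σ, fun x hx => ?_⟩, ⟨σ, fun x hx => ?_⟩⟩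
      · obtain ⟨h1, h2, h3⟩ := hσ x (Finset.mem_union_left _ hx)
        refine ⟨(Finset.mem_union.1 h1).resolve_right fun h' => hc ?_, h2, h3⟩
        obtain ⟨rfl, -⟩ := hadj _ hx _ h' h3
        exact ⟨hx, h'⟩
      · obtain ⟨h1, h2, h3⟩ := hσ x (Finset.mem_union_right _ hx)
        refine ⟨(Finset.mem_union.1 h1).resolve_left fun h' => hc ?_, h2, h3⟩
        have e := (hadj _ h' _ hx h3.symm).1
        rw [e] at h' h2
        exact ⟨h', h2.symm ▸ hx⟩
  · rintro (⟨h1, h2⟩ | ⟨⟨ha, h1⟩, hb, h2⟩)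
    · exact IsPMS.union h1 h2 h
    · have hd : Disjoint (S.erase a) (T.erase b) :=
        h.mono (Finset.erase_subset _ _) (Finset.erase_subset _ _)
      have haT := Finset.disjoint_left.1 h ha
      have hbS := Finset.disjoint_right.1 h hb
      convert IsPMS.union (IsPMS.union h1 h2 hd) (isPMS_pair hab) ?_ using 1
      · ext x
        simp only [Finset.mem_union, Finset.mem_erase, Finset.mem_insert, Finset.mem_singleton]
        by_cases hxa : x = a
        · simp [hxa, ha]
        · by_cases hxb : x = b
          · simp [hxb, hb]
          · simp [hxa, hxb]
      · simp [Finset.disjoint_right, haT, hbS]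

end Bridge

open Classical in
/-- The contribution of `S` to the perfectly matchable set polynomial. -/
noncomputable def weight (G : SimpleGraph V) (S : Finset V) : Polynomial ℤ :=
  if IsPMS G S then X ^ (S.card / 2) else 0

/-- The perfectly matchable set polynomial of `G[A]`, without finiteness of the ambient type. -/
noncomputable def poly (G : SimpleGraph V) (A : Finset V) : Polynomial ℤ :=
  ∑ S ∈ A.powerset, weight G S

theorem pmPoly_eq_poly [Fintype V] (G : SimpleGraph V) (A : Finset V) :
    pmPoly G A = poly G A := rfl

open Classical in
theorem weight_map {G : SimpleGraph V} {H : SimpleGraph W} (f : G ↪g H) (S : Finset V) :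
    weight H (S.map f.toEmbedding) = weight G S := by
  rw [weight, weight, Finset.card_map]
  exact if_congr (isPMS_map f S) rfl rfl

theorem poly_map {G : SimpleGraph V} {H : SimpleGraph W} (f : G ↪g H) (A : Finset V) :
    poly H (A.map f.toEmbedding) = poly G A := by
  classical
  symm
  refine Finset.sum_bij (fun S _ => S.map f.toEmbedding) ?_ ?_ ?_ ?_
  · intro S hS
    simpa using hS
  · intro S _ T _ h
    exact Finset.map_injective _ h
  · intro T hT
    obtain ⟨S, hS, rfl⟩ := Finset.subset_map_iff.1 (Finset.mem_powerset.1 hT)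
    exact ⟨S, Finset.mem_powerset.2 hS, rfl⟩
  · exact fun S _ => (weight_map f S).symm

@[simp]
theorem poly_empty (G : SimpleGraph V) : poly G ∅ = 1 := by
  simp [poly, weight, isPMS_empty]

@[simp]
theorem poly_singleton (G : SimpleGraph V) (a : V) : poly G {a} = 1 := by
  classical
  have : ¬ IsPMS G {a} := fun h => by simpa using even_card_of_isPMS h
  rw [poly, ← insert_empty_eq, Finset.sum_powerset_insert (by simp)]
  simp [weight, isPMS_empty, this]

section Bridge

variable [DecidableEq V] {G : SimpleGraph V}

theorem sum_powerset_union {R : Type*} [AddCommMonoid R] {A B : Finset V} (h : Disjoint A B)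
    (f : Finset V → R) :
    ∑ S ∈ (A ∪ B).powerset, f S = ∑ S ∈ A.powerset, ∑ T ∈ B.powerset, f (S ∪ T) := by
  rw [← Finset.sum_product']
  have hd := Finset.disjoint_left.1 h
  refine Finset.sum_nbij' (fun U => (U ∩ A, U ∩ B)) (fun p => p.1 ∪ p.2) ?_ ?_ ?_ ?_ ?_
  · simp
  · simp only [Finset.mem_product, Finset.mem_powerset]
    exact fun p hp => Finset.union_subset_union hp.1 hp.2
  · intro U hU
    rw [← Finset.inter_union_distrib_left]
    exact Finset.inter_eq_left.2 (Finset.mem_powerset.1 hU)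
  · rintro ⟨S, T⟩ hp
    simp only [Finset.mem_product, Finset.mem_powerset] at hp
    ext x
    · have := @hp.1 x
      have := @hp.2 x
      have := @hd x
      simp
      tauto
    · have := @hp.1 x
      have := @hp.2 x
      have := @hd x
      simp
      tauto
  · intro U hU
    rw [← Finset.inter_union_distrib_left, Finset.inter_eq_left.2 (Finset.mem_powerset.1 hU)]

theorem poly_union {A B : Finset V} (h : Disjoint A B)
    (hadj : ∀ x ∈ A, ∀ y ∈ B, ¬ G.Adj x y) : poly G (A ∪ B) = poly G A * poly G B := by
  rw [poly, sum_powerset_union h, poly, poly, Finset.sum_mul_sum]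
  refine Finset.sum_congr rfl fun S hS => Finset.sum_congr rfl fun T hT => ?_
  rw [Finset.mem_powerset] at hS hT
  have hST := h.mono hS hT
  have key := isPMS_union_iff hST fun x hx y hy => hadj x (hS hx) y (hT hy)
  by_cases h1 : IsPMS G S <;> by_cases h2 : IsPMS G T <;> simp only [weight, key, h1, h2] <;> simp
  have e1 := even_card_of_isPMS h1
  rw [Finset.card_union_of_disjoint hST, ← pow_add]
  congr 1
  grind

theorem sum_powerset_ite_mem_erase {R : Type*} [AddCommMonoid R] {A : Finset V} {a : V}
    (ha : a ∈ A) (f : Finset V → R) :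
    ∑ S ∈ A.powerset, (if a ∈ S then f (S.erase a) else 0) =
      ∑ S ∈ (A.erase a).powerset, f S := by
  conv_lhs => rw [← Finset.insert_erase ha]
  rw [Finset.sum_powerset_insert (Finset.notMem_erase a A)]
  have h : ∀ S ∈ (A.erase a).powerset, a ∉ S := fun S hS h' =>
    Finset.notMem_erase a A (Finset.mem_powerset.1 hS h')
  rw [Finset.sum_eq_zero fun S hS => if_neg (h S hS), zero_add]
  refine Finset.sum_congr rfl fun S hS => ?_
  rw [if_pos (Finset.mem_insert_self _ _), Finset.erase_insert (h S hS)]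

theorem weight_union_of_bridge {S T : Finset V} {a b : V} (h : Disjoint S T)
    (hab : G.Adj a b) (hadj : ∀ x ∈ S, ∀ y ∈ T, G.Adj x y → x = a ∧ y = b) :
    weight G (S ∪ T) = weight G S * weight G T +
      X * ((if a ∈ S then weight G (S.erase a) else 0) *
        (if b ∈ T then weight G (T.erase b) else 0)) := by
  have key := isPMS_union_iff_of_bridge h hab hadj
  by_cases hc : (a ∈ S ∧ IsPMS G (S.erase a)) ∧ b ∈ T ∧ IsPMS G (T.erase b)
  · obtain ⟨⟨ha, h1⟩, hb, h2⟩ := hc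
    have e1 := even_card_of_isPMS h1
    have e2 := even_card_of_isPMS h2
    have c1 := Finset.card_erase_add_one ha
    have c2 := Finset.card_erase_add_one hb
    have hS : ¬ IsPMS G S := fun h' => by
      have := even_card_of_isPMS h'
      grind
    simp only [weight, key, ha, hb, h1, h2, hS]
    simp only [if_true, if_false, zero_mul, zero_add]
    rw [Finset.card_union_of_disjoint h, ← pow_add, ← pow_succ']
    grind
  · have hz : ((if a ∈ S then weight G (S.erase a) else 0) *
        (if b ∈ T then weight G (T.erase b) else 0)) = 0 := by
      simp only [weight]
      split_ifs <;> simp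
      tauto
    rw [hz, mul_zero, add_zero]
    by_cases h1 : IsPMS G S <;> by_cases h2 : IsPMS G T <;>
      simp only [weight, key, hc, h1, h2] <;> simp
    have e1 := even_card_of_isPMS h1
    rw [Finset.card_union_of_disjoint h, ← pow_add]
    congr 1
    grind

theorem poly_union_of_bridge {A B : Finset V} {a b : V} (h : Disjoint A B) (ha : a ∈ A)
    (hb : b ∈ B) (hab : G.Adj a b) (hadj : ∀ x ∈ A, ∀ y ∈ B, G.Adj x y → x = a ∧ y = b) :
    poly G (A ∪ B) =
      poly G A * poly G B + X * (poly G (A.erase a) * poly G (B.erase b)) := by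
  rw [poly, sum_powerset_union h, poly, poly, poly, poly, ← sum_powerset_ite_mem_erase ha,
    ← sum_powerset_ite_mem_erase hb, Finset.sum_mul_sum, Finset.sum_mul_sum, Finset.mul_sum,
    ← Finset.sum_add_distrib]
  refine Finset.sum_congr rfl fun S hS => ?_
  rw [Finset.mul_sum, ← Finset.sum_add_distrib]
  refine Finset.sum_congr rfl fun T hT => ?_
  rw [Finset.mem_powerset] at hS hT
  exact weight_union_of_bridge (h.mono hS hT) hab fun x hx y hy => hadj x (hS hx) y (hT hy)

end Bridge

/-- The path on `ℕ`. -/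
def natPath : SimpleGraph ℕ where
  Adj a b := a + 1 = b ∨ b + 1 = a
  symm := ⟨fun _ _ => Or.symm⟩
  loopless := ⟨fun _ => by simp⟩

/-- The successor map, as an embedding of the path on `ℕ` into itself. -/
def natPathSucc : natPath ↪g natPath where
  toFun := Nat.succ
  inj' := Nat.succ_injective
  map_rel_iff' := by simp [natPath]

/-- The path on `n` vertices is an initial segment of the path on `ℕ`. -/
def pathGraphToNat (n : ℕ) : SimpleGraph.pathGraph n ↪g natPath where
  toFun := Fin.val
  inj' := Fin.val_injective
  map_rel_iff' := by simp [natPath, SimpleGraph.pathGraph_adj]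

theorem poly_pathGraph (n : ℕ) :
    poly (SimpleGraph.pathGraph n) Finset.univ = poly natPath (Finset.range n) := by
  rw [← poly_map (pathGraphToNat n)]
  congr 1
  ext x
  simp only [Finset.mem_map, Finset.mem_univ, true_and, Finset.mem_range]
  exact ⟨fun ⟨i, hi⟩ => hi ▸ i.2, fun hx => ⟨⟨x, hx⟩, rfl⟩⟩

theorem map_natPathSucc_range (n : ℕ) :
    (Finset.range n).map natPathSucc.toEmbedding = (Finset.range (n + 1)).erase 0 := by
  ext x
  simp only [Finset.mem_map, Finset.mem_range, Finset.mem_erase]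
  refine ⟨?_, fun ⟨h, h'⟩ => ⟨x - 1, by lia, Nat.succ_pred_eq_of_pos (Nat.pos_of_ne_zero h)⟩⟩
  rintro ⟨a, ha, rfl⟩
  exact ⟨Nat.succ_ne_zero a, Nat.succ_lt_succ ha⟩

theorem poly_range_add_two (n : ℕ) :
    poly natPath (Finset.range (n + 2)) =
      poly natPath (Finset.range (n + 1)) + X * poly natPath (Finset.range n) := by
  have h0 : Finset.range (n + 2) = {0} ∪ (Finset.range (n + 2)).erase 0 := by
    rw [← Finset.insert_eq, Finset.insert_erase (by simp)]
  have h1 : ((Finset.range (n + 2)).erase 0).erase 1 =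
      ((Finset.range n).map natPathSucc.toEmbedding).map natPathSucc.toEmbedding := by
    rw [map_natPathSucc_range, ← map_natPathSucc_range (n + 1), Finset.map_erase]
    rfl
  rw [h0, poly_union_of_bridge (a := 0) (b := 1) (by simp) (by simp) (by simp) (by simp [natPath])
    (by simp [natPath]; lia), h1, ← map_natPathSucc_range (n + 1)]
  simp [poly_map]

/-- The infinite `k`-ary tree, whose vertices are the finite lists of branch choices. -/
def listTree (k : ℕ) : SimpleGraph (List (Fin k)) where
  Adj a b := (∃ c, b = a ++ [c]) ∨ ∃ c, a = b ++ [c]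
  symm := ⟨fun _ _ => Or.symm⟩
  loopless := ⟨fun _ => by simp⟩

/-- Prepending a branch choice embeds the tree as the subtree at a child of the root. -/
def listTreeCons {k : ℕ} (j : Fin k) : listTree k ↪g listTree k where
  toFun := List.cons j
  inj' := List.cons_injective
  map_rel_iff' := by simp [listTree]

theorem listTree_adj_cons_cons {k : ℕ} {i j : Fin k} {a b : List (Fin k)}
    (h : (listTree k).Adj (i :: a) (j :: b)) : i = j := by
  rcases h with ⟨c, h⟩ | ⟨c, h⟩ <;> simp at h <;> simp [h.1]

theorem listTree_adj_nil_cons {k : ℕ} {j : Fin k} {b : List (Fin k)} :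
    (listTree k).Adj [] (j :: b) ↔ b = [] := by
  simp [listTree]

/-- The vertices of depth at most `r`. -/
def treeSet (k : ℕ) : ℕ → Finset (List (Fin k))
  | 0 => {[]}
  | r + 1 => insert [] (Finset.univ.biUnion fun j =>
      (treeSet k r).map (listTreeCons j).toEmbedding)

theorem mem_treeSet {k r : ℕ} {l : List (Fin k)} : l ∈ treeSet k r ↔ l.length ≤ r := by
  induction r generalizing l with
  | zero => simp [treeSet]
  | succ r ih =>
    cases l with
    | nil => simp [treeSet]
    | cons j l => simp [treeSet, ih, listTreeCons]

theorem ofFn_eq_append_singleton_iff {k m n : ℕ} (g : Fin m → Fin k) (h : Fin n → Fin k) :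
    (∃ c, List.ofFn h = List.ofFn g ++ [c]) ↔
      n = m + 1 ∧ ∀ (t : ℕ) (h1 : t < m) (h2 : t < n), g ⟨t, h1⟩ = h ⟨t, h2⟩ := by
  constructor
  · rintro ⟨c, hc⟩
    have hn : n = m + 1 := by simpa using congrArg List.length hc
    subst hn
    rw [List.ofFn_succ_last] at hc
    have := List.ofFn_injective (List.append_inj_left' hc rfl)
    exact ⟨rfl, fun t h1 _ => (congrFun this ⟨t, h1⟩).symm⟩
  · rintro ⟨rfl, hgh⟩
    refine ⟨h (Fin.last m), ?_⟩
    rw [List.ofFn_succ_last]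
    congr 2
    ext t
    exact congrArg Fin.val (hgh t t.2 (by lia)).symm

/-- A vertex of the complete tree, read as its list of branch choices. -/
def karyTreeToList (k r : ℕ) : karyTree k r ↪g listTree k where
  toFun v := List.ofFn v.2
  inj' := by
    rintro ⟨⟨i, hi⟩, g⟩ ⟨⟨j, hj⟩, h⟩ e
    have hij : i = j := by simpa using congrArg List.length e
    subst hij
    have hgh : g = h := List.ofFn_injective e
    rw [hgh]
  map_rel_iff' := by
    rintro ⟨⟨i, hi⟩, g⟩ ⟨⟨j, hj⟩, h⟩
    change (∃ c, List.ofFn h = List.ofFn g ++ [c]) ∨ (∃ c, List.ofFn g = List.ofFn h ++ [c]) ↔ _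
    rw [ofFn_eq_append_singleton_iff, ofFn_eq_append_singleton_iff, karyTree,
      SimpleGraph.fromRel_adj]
    refine ⟨fun H => ⟨fun e => ?_, H⟩, fun H => H.2⟩
    have hij := congrArg (fun v => (v.1 : ℕ)) e
    simp only at hij
    lia

theorem poly_karyTree (k r : ℕ) :
    poly (karyTree k r) Finset.univ = poly (listTree k) (treeSet k r) := by
  rw [← poly_map (karyTreeToList k r)]
  congr 1
  ext l
  simp only [Finset.mem_map, Finset.mem_univ, true_and, mem_treeSet]
  constructor
  · rintro ⟨v, rfl⟩
    exact List.length_ofFn.trans_le (Nat.lt_succ_iff.1 v.1.2)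
  · exact fun hl => ⟨⟨⟨l.length, Nat.lt_succ_of_le hl⟩, l.get⟩, List.ofFn_get l⟩

/-- The union of the subtrees of rank `r` hanging from the children of the root
whose index lies in `J`. -/
def subtrees {k : ℕ} (r : ℕ) (J : Finset (Fin k)) : Finset (List (Fin k)) :=
  J.biUnion fun j => (treeSet k r).map (listTreeCons j).toEmbedding

theorem mem_subtrees {k r : ℕ} {J : Finset (Fin k)} {l : List (Fin k)} :
    l ∈ subtrees r J ↔ ∃ j ∈ J, ∃ a ∈ treeSet k r, j :: a = l := by
  simp [subtrees, listTreeCons]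

theorem nil_notMem_subtrees {k r : ℕ} {J : Finset (Fin k)} : [] ∉ subtrees r J := by
  simp [mem_subtrees]

theorem subtrees_insert {k : ℕ} (r : ℕ) (J : Finset (Fin k)) (j : Fin k) :
    subtrees r (insert j J) =
      subtrees r J ∪ (treeSet k r).map (listTreeCons j).toEmbedding := by
  rw [subtrees, Finset.biUnion_insert, Finset.union_comm, subtrees]

theorem disjoint_subtrees {k r : ℕ} {J : Finset (Fin k)} {j : Fin k} (hj : j ∉ J) :
    Disjoint (subtrees r J) ((treeSet k r).map (listTreeCons j).toEmbedding) := by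
  rw [Finset.disjoint_left]
  intro l hl hl'
  obtain ⟨i, hi, a, -, rfl⟩ := mem_subtrees.1 hl
  obtain ⟨b, -, e⟩ := Finset.mem_map.1 hl'
  exact hj ((List.cons.inj e).1 ▸ hi)

theorem not_adj_subtrees {k r : ℕ} {J : Finset (Fin k)} {j : Fin k} (hj : j ∉ J) :
    ∀ x ∈ subtrees r J, ∀ y ∈ (treeSet k r).map (listTreeCons j).toEmbedding,
      ¬ (listTree k).Adj x y := by
  intro x hx y hy h
  obtain ⟨i, hi, a, -, rfl⟩ := mem_subtrees.1 hx
  obtain ⟨b, -, rfl⟩ := Finset.mem_map.1 hy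
  exact hj (listTree_adj_cons_cons h ▸ hi)

theorem poly_subtrees {k : ℕ} (r : ℕ) (J : Finset (Fin k)) :
    poly (listTree k) (subtrees r J) = poly (listTree k) (treeSet k r) ^ J.card := by
  induction J using Finset.induction_on with
  | empty => simp [subtrees]
  | insert j J hj ih =>
    rw [subtrees_insert, poly_union (disjoint_subtrees hj) (not_adj_subtrees hj), ih, poly_map,
      Finset.card_insert_of_notMem hj, pow_succ]

theorem poly_insert_nil_subtrees {k : ℕ} (r : ℕ) (J : Finset (Fin k)) :
    poly (listTree k) (insert [] (subtrees r J)) =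
      poly (listTree k) (treeSet k r) ^ J.card +
        (J.card : Polynomial ℤ) * X * poly (listTree k) (treeSet k r) ^ (J.card - 1) *
          poly (listTree k) ((treeSet k r).erase []) := by
  induction J using Finset.induction_on with
  | empty => simp [subtrees]
  | insert j J hj ih =>
    have hd : Disjoint (insert [] (subtrees r J))
        ((treeSet k r).map (listTreeCons j).toEmbedding) := by
      rw [Finset.disjoint_insert_left]
      exact ⟨by simp [listTreeCons], disjoint_subtrees hj⟩
    have hb : [j] ∈ (treeSet k r).map (listTreeCons j).toEmbedding :=
      Finset.mem_map_of_mem (listTreeCons j).toEmbedding (mem_treeSet.2 (Nat.zero_le r))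
    have he : ((treeSet k r).map (listTreeCons j).toEmbedding).erase [j] =
        ((treeSet k r).erase []).map (listTreeCons j).toEmbedding := by
      rw [Finset.map_erase]
      rfl
    rw [subtrees_insert, ← Finset.insert_union, poly_union_of_bridge hd
      (Finset.mem_insert_self _ _) hb (listTree_adj_nil_cons.2 rfl), he, poly_map, poly_map,
      Finset.erase_insert nil_notMem_subtrees, poly_subtrees, ih,
      Finset.card_insert_of_notMem hj, Nat.add_sub_cancel]
    · rcases Nat.eq_zero_or_pos J.card with h | h
      · simp [h]
      · obtain ⟨m, hm⟩ := Nat.exists_eq_add_of_lt h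
        rw [hm]
        simp only [zero_add, Nat.add_sub_cancel]
        push_cast
        ring
    · intro x hx y hy h
      obtain ⟨b, -, rfl⟩ := Finset.mem_map.1 hy
      rcases Finset.mem_insert.1 hx with rfl | hx
      · exact ⟨rfl, congrArg (List.cons j) (listTree_adj_nil_cons.1 h)⟩
      · exact absurd h (not_adj_subtrees hj x hx _ hy)

theorem poly_treeSet_succ (k r : ℕ) :
    poly (listTree k) (treeSet k (r + 1)) =
      poly (listTree k) (treeSet k r) ^ k +
        (k : Polynomial ℤ) * X * poly (listTree k) (treeSet k r) ^ (k - 1) *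
          poly (listTree k) ((treeSet k r).erase []) := by
  have h : treeSet k (r + 1) = insert [] (subtrees r Finset.univ) := rfl
  simpa [h] using poly_insert_nil_subtrees r (Finset.univ : Finset (Fin k))

theorem poly_treeSet_succ_erase (k r : ℕ) :
    poly (listTree k) ((treeSet k (r + 1)).erase []) =
      poly (listTree k) (treeSet k r) ^ k := by
  have h : treeSet k (r + 1) = insert [] (subtrees r Finset.univ) := rfl
  rw [h, Finset.erase_insert nil_notMem_subtrees]
  simpa using poly_subtrees r (Finset.univ : Finset (Fin k))

theorem poly_treeSet_zero (k : ℕ) : poly (listTree k) (treeSet k 0) = 1 :=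
  poly_singleton _ _

theorem poly_treeSet_one (k : ℕ) : poly (listTree k) (treeSet k 1) = 1 + (k : Polynomial ℤ) * X := by
  have h : (treeSet k 0).erase [] = ∅ := by simp [treeSet]
  rw [poly_treeSet_succ, poly_treeSet_zero, h]
  simp

theorem poly_treeSet_add_two (k r : ℕ) :
    poly (listTree k) (treeSet k (r + 2)) =
      poly (listTree k) (treeSet k (r + 1)) ^ k +
        (k : Polynomial ℤ) * X * poly (listTree k) (treeSet k (r + 1)) ^ (k - 1) *
          poly (listTree k) (treeSet k r) ^ k := by
  rw [poly_treeSet_succ, poly_treeSet_succ_erase]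

theorem poly_range_comp_add_two (p : Polynomial ℤ) (n : ℕ) :
    (poly natPath (Finset.range (n + 2))).comp p =
      (poly natPath (Finset.range (n + 1))).comp p +
        p * (poly natPath (Finset.range n)).comp p := by
  simp [poly_range_add_two]

theorem poly_treeSet_eq (k r : ℕ) :
    poly (listTree k) (treeSet k r) =
      (poly natPath (Finset.range (r + 1))).comp ((k : Polynomial ℤ) * X) *
        ∏ i ∈ Finset.Icc 1 (r - 1), poly (listTree k) (treeSet k i) ^ (k - 1) := by
  have hp1 : ((poly natPath (Finset.range 2)).comp ((k : Polynomial ℤ) * X)) = 1 + (k : Polynomial ℤ) * X := by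
    rw [poly_range_comp_add_two]
    simp
  induction r using Nat.strong_induction_on with
  | _ r ih =>
    match r with
    | 0 => simp [poly_treeSet_zero]
    | 1 => simp [poly_treeSet_one, hp1]
    | r + 2 =>
      rw [poly_treeSet_add_two, poly_range_comp_add_two, show r + 2 - 1 = r + 1 from rfl,
        Finset.prod_Icc_succ_top (by lia)]
      rcases k with _ | k
      · have h1 := ih (r + 1) (by lia)
        rw [poly_treeSet_succ] at h1
        simpa using h1
      · have h1 := ih (r + 1) (by lia)
        have h0 := ih r (by lia)
        have hP : poly (listTree (k + 1)) (treeSet (k + 1) r) ^ k *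
            ∏ i ∈ Finset.Icc 1 (r - 1), poly (listTree (k + 1)) (treeSet (k + 1) i) ^ k =
              ∏ i ∈ Finset.Icc 1 r, poly (listTree (k + 1)) (treeSet (k + 1) i) ^ k := by
          rcases r with _ | r
          · simp [poly_treeSet_zero]
          · rw [Finset.prod_Icc_succ_top (by lia), mul_comm, Nat.add_sub_cancel]
        simp only [Nat.add_sub_cancel] at h0 h1 ⊢
        set T₁ := poly (listTree (k + 1)) (treeSet (k + 1) (r + 1))
        set T₀ := poly (listTree (k + 1)) (treeSet (k + 1) r)
        set z : Polynomial ℤ := ((k + 1 : ℕ) : Polynomial ℤ) * X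
        linear_combination T₁ ^ k * h1 + z * T₁ ^ k * T₀ ^ k * h0 +
          z * T₁ ^ k * (poly natPath (Finset.range (r + 1))).comp z * hP

end PMSet

/-- for all `k, r ≥ 0`,
`p(Λ_{k,r}; z) = p(P_{r+1}; kz) · ∏_{i=1}^{r−1} p(Λ_{k,i}; z)^{k−1}`. -/
theorem stmt17 (k r : ℕ) :
    pmPoly (karyTree k r) Finset.univ =
      (pmPoly (SimpleGraph.pathGraph (r + 1)) Finset.univ).comp ((k : Polynomial ℤ) * X) *
        ∏ i ∈ Finset.Icc 1 (r - 1), pmPoly (karyTree k i) Finset.univ ^ (k - 1) := by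
  simp only [PMSet.pmPoly_eq_poly, PMSet.poly_karyTree, PMSet.poly_pathGraph]
  exact PMSet.poly_treeSet_eq k r
end
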